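/- arXiv:2605.24151 — 3 statements merged into one kernel-verified Lean document; each statement's English description precedes it below -/
import Mathlib

section
/- Let k₀ > 0 and let ρ > 0, θ be smooth functions of (x,y,z) satisfying the continuity equation ∂_z ρ + (1/k₀) div(ρ∇θ) = 0 and the Hamilton–Jacobi identity k₀ ∂_z θ + ½|∇θ|² = ½ Q(ρ), where Q(ρ) = Δ√ρ/√ρ. Define the momentum density m := (1/k₀) ρ ∇θ and the quantum stress tensor S(ρ) := (1/(2k₀²))(∇w ⊗ ∇w − w ∇²w) with w := √ρ. Then the local conservative momentum balance ∂_z m + div( (1/k₀²) ρ ∇θ ⊗ ∇θ + S(ρ) ) = 0 holds pointwise. -/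
open MeasureTheory

noncomputable section

/-- Partial derivative in the first (x) variable of a function of (x, y, z). -/
def dX (f : ℝ → ℝ → ℝ → ℝ) (x y z : ℝ) : ℝ := deriv (fun t => f t y z) x

/-- Partial derivative in the second (y) variable of a function of (x, y, z). -/
def dY (f : ℝ → ℝ → ℝ → ℝ) (x y z : ℝ) : ℝ := deriv (fun t => f x t z) y

/-- Partial derivative in the third (z, propagation) variable. -/
def dZ (f : ℝ → ℝ → ℝ → ℝ) (x y z : ℝ) : ℝ := deriv (fun t => f x y t) z

/-- `w := √ρ`. -/
def sqrtF (ρ : ℝ → ℝ → ℝ → ℝ) (x y z : ℝ) : ℝ := Real.sqrt (ρ x y z)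

/-- The quantum pressure `Q(ρ) = Δ√ρ / √ρ`. -/
def Qp (ρ : ℝ → ℝ → ℝ → ℝ) (x y z : ℝ) : ℝ :=
  (dX (dX (sqrtF ρ)) x y z + dY (dY (sqrtF ρ)) x y z) / sqrtF ρ x y z

/-- Quantum stress tensor entry `S₁₁ = (1/(2k₀²))(w_x w_x − w w_{xx})`, `w = √ρ`. -/
def S11 (k₀ : ℝ) (ρ : ℝ → ℝ → ℝ → ℝ) (x y z : ℝ) : ℝ :=
  (1 / (2 * k₀ ^ 2)) *
    (dX (sqrtF ρ) x y z * dX (sqrtF ρ) x y z - sqrtF ρ x y z * dX (dX (sqrtF ρ)) x y z)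

/-- Quantum stress tensor entry `S₁₂ = (1/(2k₀²))(w_x w_y − w w_{xy})`. -/
def S12 (k₀ : ℝ) (ρ : ℝ → ℝ → ℝ → ℝ) (x y z : ℝ) : ℝ :=
  (1 / (2 * k₀ ^ 2)) *
    (dX (sqrtF ρ) x y z * dY (sqrtF ρ) x y z - sqrtF ρ x y z * dX (dY (sqrtF ρ)) x y z)

/-- Quantum stress tensor entry `S₂₁ = (1/(2k₀²))(w_y w_x − w w_{yx})`. -/
def S21 (k₀ : ℝ) (ρ : ℝ → ℝ → ℝ → ℝ) (x y z : ℝ) : ℝ :=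
  (1 / (2 * k₀ ^ 2)) *
    (dY (sqrtF ρ) x y z * dX (sqrtF ρ) x y z - sqrtF ρ x y z * dY (dX (sqrtF ρ)) x y z)

/-- Quantum stress tensor entry `S₂₂ = (1/(2k₀²))(w_y w_y − w w_{yy})`. -/
def S22 (k₀ : ℝ) (ρ : ℝ → ℝ → ℝ → ℝ) (x y z : ℝ) : ℝ :=
  (1 / (2 * k₀ ^ 2)) *
    (dY (sqrtF ρ) x y z * dY (sqrtF ρ) x y z - sqrtF ρ x y z * dY (dY (sqrtF ρ)) x y z)

/-- Smoothness of the uncurried function. -/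
def Sm (f : ℝ → ℝ → ℝ → ℝ) : Prop :=
  ContDiff ℝ (⊤ : ℕ∞) (fun p : ℝ × ℝ × ℝ => f p.1 p.2.1 p.2.2)

/-- Uncurried function. -/
def Un (f : ℝ → ℝ → ℝ → ℝ) (p : ℝ × ℝ × ℝ) : ℝ := f p.1 p.2.1 p.2.2

theorem Sm.diff {f} (h : Sm f) : Differentiable ℝ (Un f) :=
  ContDiff.differentiable h (by simp)

theorem Sm.hX0 {f} (h : Sm f) (x y z : ℝ) :
    HasDerivAt (fun t => f t y z) (fderiv ℝ (Un f) (x, y, z) (1, 0, 0)) x := by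
  have h1 : HasDerivAt (fun t : ℝ => (t, y, z)) ((1 : ℝ), (0 : ℝ), (0 : ℝ)) x :=
    (hasDerivAt_id x).prodMk ((hasDerivAt_const x y).prodMk (hasDerivAt_const x z))
  exact (h.diff (x, y, z)).hasFDerivAt.comp_hasDerivAt x h1

theorem Sm.hY0 {f} (h : Sm f) (x y z : ℝ) :
    HasDerivAt (fun t => f x t z) (fderiv ℝ (Un f) (x, y, z) (0, 1, 0)) y := by
  have h1 : HasDerivAt (fun t : ℝ => (x, t, z)) ((0 : ℝ), (1 : ℝ), (0 : ℝ)) y :=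
    (hasDerivAt_const y x).prodMk ((hasDerivAt_id y).prodMk (hasDerivAt_const y z))
  exact (h.diff (x, y, z)).hasFDerivAt.comp_hasDerivAt y h1

theorem Sm.hZ0 {f} (h : Sm f) (x y z : ℝ) :
    HasDerivAt (fun t => f x y t) (fderiv ℝ (Un f) (x, y, z) (0, 0, 1)) z := by
  have h1 : HasDerivAt (fun t : ℝ => (x, y, t)) ((0 : ℝ), (0 : ℝ), (1 : ℝ)) z :=
    (hasDerivAt_const z x).prodMk ((hasDerivAt_const z y).prodMk (hasDerivAt_id z))
  exact (h.diff (x, y, z)).hasFDerivAt.comp_hasDerivAt z h1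

theorem Sm.eX {f} (h : Sm f) : Un (dX f) = fun p => fderiv ℝ (Un f) p (1, 0, 0) := by
  funext p; exact (h.hX0 p.1 p.2.1 p.2.2).deriv
theorem Sm.eY {f} (h : Sm f) : Un (dY f) = fun p => fderiv ℝ (Un f) p (0, 1, 0) := by
  funext p; exact (h.hY0 p.1 p.2.1 p.2.2).deriv
theorem Sm.eZ {f} (h : Sm f) : Un (dZ f) = fun p => fderiv ℝ (Un f) p (0, 0, 1) := by
  funext p; exact (h.hZ0 p.1 p.2.1 p.2.2).deriv

theorem Sm.hX {f} (h : Sm f) (x y z : ℝ) : HasDerivAt (fun t => f t y z) (dX f x y z) x :=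
  (h.hX0 x y z).differentiableAt.hasDerivAt
theorem Sm.hY {f} (h : Sm f) (x y z : ℝ) : HasDerivAt (fun t => f x t z) (dY f x y z) y :=
  (h.hY0 x y z).differentiableAt.hasDerivAt
theorem Sm.hZ {f} (h : Sm f) (x y z : ℝ) : HasDerivAt (fun t => f x y t) (dZ f x y z) z :=
  (h.hZ0 x y z).differentiableAt.hasDerivAt

theorem Sm.fd {f} (h : Sm f) : ContDiff ℝ (⊤ : ℕ∞) (fderiv ℝ (Un f)) :=
  ContDiff.fderiv_right (m := (⊤ : ℕ∞)) h (by simp)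

theorem Sm.dX {f} (h : Sm f) : Sm (dX f) := by
  change ContDiff ℝ _ (Un (_root_.dX f)); rw [h.eX]; exact h.fd.clm_apply contDiff_const
theorem Sm.dY {f} (h : Sm f) : Sm (dY f) := by
  change ContDiff ℝ _ (Un (_root_.dY f)); rw [h.eY]; exact h.fd.clm_apply contDiff_const
theorem Sm.dZ {f} (h : Sm f) : Sm (dZ f) := by
  change ContDiff ℝ _ (Un (_root_.dZ f)); rw [h.eZ]; exact h.fd.clm_apply contDiff_const

theorem Sm.symm {f} (h : Sm f) (p u v : ℝ × ℝ × ℝ) :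
    fderiv ℝ (fun q => fderiv ℝ (Un f) q u) p v = fderiv ℝ (fun q => fderiv ℝ (Un f) q v) p u := by
  have hs : IsSymmSndFDerivAt ℝ (Un f) p :=
    ContDiffAt.isSymmSndFDerivAt (n := (⊤ : ℕ∞)) (ContDiff.contDiffAt h)
      (by simp only [minSmoothness_of_isRCLikeNormedField]; exact WithTop.coe_le_coe.2 (le_top : (2 : ℕ∞) ≤ ⊤))
  have hd : DifferentiableAt ℝ (fderiv ℝ (Un f)) p := h.fd.differentiable (by simp) p
  rw [fderiv_clm_apply hd (by fun_prop), fderiv_clm_apply hd (by fun_prop)]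
  simpa using hs v u

theorem Sm.XY {f} (h : Sm f) (x y z : ℝ) : _root_.dY (_root_.dX f) x y z = _root_.dX (_root_.dY f) x y z := by
  change Un (_root_.dY (_root_.dX f)) (x, y, z) = Un (_root_.dX (_root_.dY f)) (x, y, z)
  rw [h.dX.eY, h.dY.eX, h.eX, h.eY]; exact h.symm _ _ _
theorem Sm.XZ {f} (h : Sm f) (x y z : ℝ) : _root_.dZ (_root_.dX f) x y z = _root_.dX (_root_.dZ f) x y z := by
  change Un (_root_.dZ (_root_.dX f)) (x, y, z) = Un (_root_.dX (_root_.dZ f)) (x, y, z)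
  rw [h.dX.eZ, h.dZ.eX, h.eX, h.eZ]; exact h.symm _ _ _
theorem Sm.YZ {f} (h : Sm f) (x y z : ℝ) : _root_.dZ (_root_.dY f) x y z = _root_.dY (_root_.dZ f) x y z := by
  change Un (_root_.dZ (_root_.dY f)) (x, y, z) = Un (_root_.dY (_root_.dZ f)) (x, y, z)
  rw [h.dY.eZ, h.dZ.eY, h.eY, h.eZ]; exact h.symm _ _ _

theorem Sm.sqrtF {f} (h : Sm f) (hp : ∀ x y z, 0 < f x y z) : Sm (sqrtF f) :=
  ContDiff.sqrt h (fun p => (hp _ _ _).ne')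

/-- **Local conservative momentum balance.** If `ρ > 0`, `θ` are smooth, the continuity
equation `∂_z ρ + (1/k₀) div(ρ∇θ) = 0` and the Hamilton–Jacobi identity
`k₀ ∂_z θ + ½|∇θ|² = ½ Q(ρ)` hold, then the momentum density `m = (1/k₀) ρ∇θ` satisfies
`∂_z m + div((1/k₀²) ρ ∇θ ⊗ ∇θ + S(ρ)) = 0` pointwise (stated componentwise,
with the divergence of the matrix field taken row-wise). -/
theorem local_momentum_balance
    (k₀ : ℝ) (hk₀ : 0 < k₀)
    (ρ θ : ℝ → ℝ → ℝ → ℝ)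
    (hρ_pos : ∀ x y z : ℝ, 0 < ρ x y z)
    (hρ_smooth : ContDiff ℝ (⊤ : ℕ∞) (fun p : ℝ × ℝ × ℝ => ρ p.1 p.2.1 p.2.2))
    (hθ_smooth : ContDiff ℝ (⊤ : ℕ∞) (fun p : ℝ × ℝ × ℝ => θ p.1 p.2.1 p.2.2))
    (continuity : ∀ x y z : ℝ,
      dZ ρ x y z
        + (1 / k₀) * (dX (fun a b c => ρ a b c * dX θ a b c) x y z
            + dY (fun a b c => ρ a b c * dY θ a b c) x y z) = 0)
    (hamilton_jacobi : ∀ x y z : ℝ,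
      k₀ * dZ θ x y z + (1 / 2) * ((dX θ x y z) ^ 2 + (dY θ x y z) ^ 2)
        = (1 / 2) * Qp ρ x y z) :
    ∀ x y z : ℝ,
      (dZ (fun a b c => (1 / k₀) * ρ a b c * dX θ a b c) x y z
        + dX (fun a b c => (1 / k₀ ^ 2) * ρ a b c * dX θ a b c * dX θ a b c
            + S11 k₀ ρ a b c) x y z
        + dY (fun a b c => (1 / k₀ ^ 2) * ρ a b c * dX θ a b c * dY θ a b c
            + S12 k₀ ρ a b c) x y z = 0)
      ∧
      (dZ (fun a b c => (1 / k₀) * ρ a b c * dY θ a b c) x y z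
        + dX (fun a b c => (1 / k₀ ^ 2) * ρ a b c * dY θ a b c * dX θ a b c
            + S21 k₀ ρ a b c) x y z
        + dY (fun a b c => (1 / k₀ ^ 2) * ρ a b c * dY θ a b c * dY θ a b c
            + S22 k₀ ρ a b c) x y z = 0) := by
  intro x y z
  have hr : Sm ρ := hρ_smooth
  have ht : Sm θ := hθ_smooth
  have hw : Sm (sqrtF ρ) := hr.sqrtF hρ_pos
  have hwp : ∀ x y z, 0 < sqrtF ρ x y z := fun x y z => Real.sqrt_pos.2 (hρ_pos x y z)
  have hsq : ρ x y z = sqrtF ρ x y z ^ 2 := (Real.sq_sqrt (hρ_pos x y z).le).symm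
  have hk := hk₀.ne'
  have hw0 := (hwp x y z).ne'
  have C := continuity x y z
  have c1 : dX (fun a b c => ρ a b c * dX θ a b c) x y z = _ :=
    ((hr.hX x y z).mul (ht.dX.hX x y z)).deriv
  have c2 : dY (fun a b c => ρ a b c * dY θ a b c) x y z = _ :=
    ((hr.hY x y z).mul (ht.dY.hY x y z)).deriv
  rw [c1, c2] at C
  -- x and y derivatives of Hamilton-Jacobi
  have HX : _ = _ := ((((ht.dZ.hX x y z).const_mul k₀).add
    ((((ht.dX.hX x y z).pow 2).add ((ht.dY.hX x y z).pow 2)).const_mul (1 / 2))).unique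
    (((((hw.dX.dX.hX x y z).add (hw.dY.dY.hX x y z)).div (hw.hX x y z) hw0).const_mul
      (1 / 2)).congr_of_eventuallyEq (Filter.Eventually.of_forall
        fun t => hamilton_jacobi t y z)))
  have HY : _ = _ := ((((ht.dZ.hY x y z).const_mul k₀).add
    ((((ht.dX.hY x y z).pow 2).add ((ht.dY.hY x y z).pow 2)).const_mul (1 / 2))).unique
    (((((hw.dX.dX.hY x y z).add (hw.dY.dY.hY x y z)).div (hw.hY x y z) hw0).const_mul
      (1 / 2)).congr_of_eventuallyEq (Filter.Eventually.of_forall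
        fun t => hamilton_jacobi x t z)))
  have a1 : dZ (fun a b c => (1 / k₀) * ρ a b c * dX θ a b c) x y z = _ :=
    (((hr.hZ x y z).const_mul (1 / k₀)).mul (ht.dX.hZ x y z)).deriv
  have a2 : dX (fun a b c => (1 / k₀ ^ 2) * ρ a b c * dX θ a b c * dX θ a b c
            + S11 k₀ ρ a b c) x y z = _ :=
    (((((hr.hX x y z).const_mul (1 / k₀ ^ 2)).mul (ht.dX.hX x y z)).mul (ht.dX.hX x y z)).add
      ((((hw.dX.hX x y z).mul (hw.dX.hX x y z)).sub
        ((hw.hX x y z).mul (hw.dX.dX.hX x y z))).const_mul (1 / (2 * k₀ ^ 2)))).deriv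
  have a3 : dY (fun a b c => (1 / k₀ ^ 2) * ρ a b c * dX θ a b c * dY θ a b c
            + S12 k₀ ρ a b c) x y z = _ :=
    (((((hr.hY x y z).const_mul (1 / k₀ ^ 2)).mul (ht.dX.hY x y z)).mul (ht.dY.hY x y z)).add
      ((((hw.dX.hY x y z).mul (hw.dY.hY x y z)).sub
        ((hw.hY x y z).mul (hw.dY.dX.hY x y z))).const_mul (1 / (2 * k₀ ^ 2)))).deriv
  have b1 : dZ (fun a b c => (1 / k₀) * ρ a b c * dY θ a b c) x y z = _ :=
    (((hr.hZ x y z).const_mul (1 / k₀)).mul (ht.dY.hZ x y z)).deriv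
  have b2 : dX (fun a b c => (1 / k₀ ^ 2) * ρ a b c * dY θ a b c * dX θ a b c
            + S21 k₀ ρ a b c) x y z = _ :=
    (((((hr.hX x y z).const_mul (1 / k₀ ^ 2)).mul (ht.dY.hX x y z)).mul (ht.dX.hX x y z)).add
      ((((hw.dY.hX x y z).mul (hw.dX.hX x y z)).sub
        ((hw.hX x y z).mul (hw.dX.dY.hX x y z))).const_mul (1 / (2 * k₀ ^ 2)))).deriv
  have b3 : dY (fun a b c => (1 / k₀ ^ 2) * ρ a b c * dY θ a b c * dY θ a b c
            + S22 k₀ ρ a b c) x y z = _ :=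
    (((((hr.hY x y z).const_mul (1 / k₀ ^ 2)).mul (ht.dY.hY x y z)).mul (ht.dY.hY x y z)).add
      ((((hw.dY.hY x y z).mul (hw.dY.hY x y z)).sub
        ((hw.hY x y z).mul (hw.dY.dY.hY x y z))).const_mul (1 / (2 * k₀ ^ 2)))).deriv
  have e1 : dX (dY (dX (sqrtF ρ))) x y z = dY (dX (dX (sqrtF ρ))) x y z := (hw.dX.XY x y z).symm
  have e2 : dY (dX (dY (sqrtF ρ))) x y z = dX (dY (dY (sqrtF ρ))) x y z := hw.dY.XY x y z
  rw [a1, a2, a3, b1, b2, b3]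
  simp only [ht.XY, ht.XZ, ht.YZ, hw.XY, e1, e2, hsq, Pi.add_apply, Pi.pow_apply, Pi.mul_apply] at C HX HY ⊢
  generalize sqrtF ρ x y z = w at *
  have Z1 : dZ ρ x y z = _ := eq_neg_of_add_eq_zero_left C
  have TX : dX (dZ θ) x y z = _ := eq_div_of_mul_eq hk ((mul_comm _ _).trans (eq_sub_of_add_eq HX))
  have TY : dY (dZ θ) x y z = _ := eq_div_of_mul_eq hk ((mul_comm _ _).trans (eq_sub_of_add_eq HY))
  rw [Z1, TX, TY]
  constructor
  · field_simp
    ring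
  · field_simp
    ring

end
end

section
/- Let N_x, N_y ≥ 1, Δx, Δy, Δz > 0, let y_j := −L + (j−½)Δy be the uniform cell-center y-coordinates, let ρ be a grid function with discrete mass M_h := Σ_{i,j} ρ_{i,j} Δx Δy > 0, and let ρ⁺ be the forward Euler finite-volume update ρ⁺_{i,j} = ρ_{i,j} − Δz( (F^x_{i+½,j} − F^x_{i−½,j})/Δx + (F^y_{i,j+½} − F^y_{i,j−½})/Δy ) with zero boundary face fluxes. Assume moreover M_h(ρ⁺) = M_h(ρ) = M_h. Then the discrete centroid y_{c,h}(ρ) := (1/M_h) Σ_{i,j} y_j ρ_{i,j} Δx Δy satisfies y_{c,h}(ρ⁺) − y_{c,h}(ρ) = (Δz/M_h) Σ_{i=1}^{N_x} Σ_{j=1}^{N_y−1} F^y_{i,j+½} Δx Δy. -/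
theorem aux_tele (n : ℕ) (g : Fin (n + 1) → ℝ) :
    ∑ j : Fin n, (g j.succ - g j.castSucc) = g (Fin.last n) - g 0 := by
  have h1 := Fin.sum_univ_succ g
  have h2 := Fin.sum_univ_castSucc g
  rw [Finset.sum_sub_distrib]
  linarith

theorem aux_Ioo (n : ℕ) (g : Fin (n + 1) → ℝ) (h0 : g 0 = 0) (h1 : g (Fin.last n) = 0) :
    ∑ k ∈ Finset.Ioo (0 : Fin (n + 1)) (Fin.last n), g k = ∑ k, g k := by
  apply Finset.sum_subset (Finset.subset_univ _)
  intro x _ hx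
  rw [Finset.mem_Ioo, not_and_or] at hx
  rcases hx with hx | hx
  · have : x = 0 := by
      by_contra h
      exact hx (Fin.pos_iff_ne_zero.mpr h)
    rw [this, h0]
  · have : x = Fin.last n := by
      by_contra h
      exact hx (Fin.lt_last_iff_ne_last.mpr h)
    rw [this, h1]

theorem aux_parts (n : ℕ) (g : Fin (n + 1) → ℝ) (h0 : g 0 = 0) (h1 : g (Fin.last n) = 0)
    (L d : ℝ) :
    ∑ j : Fin n, (-L + ((j.val : ℝ) + 1 / 2) * d) * (g j.succ - g j.castSucc)
      = - d * ∑ k ∈ Finset.Ioo (0 : Fin (n + 1)) (Fin.last n), g k := by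
  have ht := aux_tele n (fun k => (-L + ((k.val : ℝ) + 1 / 2) * d) * g k)
  have hs := Fin.sum_univ_succ g
  rw [aux_Ioo n g h0 h1, hs, h0, zero_add, Finset.mul_sum]
  simp only [h0, h1, mul_zero, sub_zero] at ht
  rw [← sub_eq_zero, ← Finset.sum_sub_distrib, ← ht]
  apply Finset.sum_congr rfl
  intro j _
  simp only [Fin.val_succ, Fin.val_castSucc]
  push_cast
  ring

/-- **Discrete centroid increment identity.** For the forward Euler finite-volume
update with zero boundary face fluxes and conserved discrete mass `M_h > 0`, the
discrete centroid `y_{c,h}(ρ) = (1/M_h) Σ_{i,j} y_j ρ_{i,j} Δx Δy`, with cell-center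
coordinates `y_j = −L + (j − ½)Δy`, satisfies
`y_{c,h}(ρ⁺) − y_{c,h}(ρ) = (Δz/M_h) Σ_{i=1}^{Nx} Σ_{j=1}^{Ny−1} F^y_{i,j+½} Δx Δy`
(the `j`-sum runs over the interior horizontal faces).
Cells are zero-indexed by `Fin Nx × Fin Ny`, so `y_j = −L + ((j:ℝ) + ½)Δy`; horizontal
faces are indexed by `Fin (Ny+1)`, the interior ones forming `Finset.Ioo 0 (Fin.last Ny)`. -/
theorem discrete_centroid_increment
    (Nx Ny : ℕ) (hNx : 1 ≤ Nx) (hNy : 1 ≤ Ny)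
    (L Δx Δy Δz : ℝ) (hΔx : 0 < Δx) (hΔy : 0 < Δy) (hΔz : 0 < Δz)
    (ρ ρplus : Fin Nx → Fin Ny → ℝ)
    (Fx : Fin (Nx + 1) → Fin Ny → ℝ) (Fy : Fin Nx → Fin (Ny + 1) → ℝ)
    (hFx_left : ∀ j, Fx 0 j = 0) (hFx_right : ∀ j, Fx (Fin.last Nx) j = 0)
    (hFy_bot : ∀ i, Fy i 0 = 0) (hFy_top : ∀ i, Fy i (Fin.last Ny) = 0)
    (hupdate : ∀ i j, ρplus i j
      = ρ i j - Δz * ((Fx i.succ j - Fx i.castSucc j) / Δx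
          + (Fy i j.succ - Fy i j.castSucc) / Δy))
    (Mh : ℝ) (hMh_pos : 0 < Mh)
    (hMh : (∑ i, ∑ j, ρ i j * (Δx * Δy)) = Mh)
    (hMh_plus : (∑ i, ∑ j, ρplus i j * (Δx * Δy)) = Mh) :
    (1 / Mh) * (∑ i, ∑ j : Fin Ny, (-L + ((j.val : ℝ) + 1 / 2) * Δy) * ρplus i j * (Δx * Δy))
      - (1 / Mh) * (∑ i, ∑ j : Fin Ny, (-L + ((j.val : ℝ) + 1 / 2) * Δy) * ρ i j * (Δx * Δy))
      = (Δz / Mh) *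
          ∑ i : Fin Nx, ∑ k ∈ Finset.Ioo (0 : Fin (Ny + 1)) (Fin.last Ny),
            Fy i k * (Δx * Δy) := by
  have hx : ∑ i : Fin Nx, ∑ j : Fin Ny, (-L + ((j.val : ℝ) + 1 / 2) * Δy)
      * (Fx i.succ j - Fx i.castSucc j) = 0 := by
    rw [Finset.sum_comm]
    apply Finset.sum_eq_zero
    intro j _
    rw [← Finset.mul_sum, aux_tele Nx (fun k => Fx k j), hFx_left, hFx_right]
    ring
  have hy : ∑ i : Fin Nx, ∑ j : Fin Ny, (-L + ((j.val : ℝ) + 1 / 2) * Δy)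
      * (Fy i j.succ - Fy i j.castSucc)
      = - Δy * ∑ i : Fin Nx, ∑ k ∈ Finset.Ioo (0 : Fin (Ny + 1)) (Fin.last Ny), Fy i k := by
    rw [Finset.mul_sum]
    exact Finset.sum_congr rfl fun i _ => aux_parts Ny (Fy i) (hFy_bot i) (hFy_top i) L Δy
  have key : (∑ i, ∑ j : Fin Ny, (-L + ((j.val : ℝ) + 1 / 2) * Δy) * ρplus i j * (Δx * Δy))
      = (∑ i, ∑ j : Fin Ny, (-L + ((j.val : ℝ) + 1 / 2) * Δy) * ρ i j * (Δx * Δy))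
        - Δz * Δy * (∑ i : Fin Nx, ∑ j : Fin Ny, (-L + ((j.val : ℝ) + 1 / 2) * Δy)
            * (Fx i.succ j - Fx i.castSucc j))
        - Δz * Δx * (∑ i : Fin Nx, ∑ j : Fin Ny, (-L + ((j.val : ℝ) + 1 / 2) * Δy)
            * (Fy i j.succ - Fy i j.castSucc)) := by
    simp only [Finset.mul_sum, ← Finset.sum_sub_distrib]
    refine Finset.sum_congr rfl fun i _ => Finset.sum_congr rfl fun j _ => ?_
    rw [hupdate]
    field_simp
    ring
  rw [key, hx, hy]
  simp only [← Finset.sum_mul]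
  ring
end

section
/- The Rusanov forward Euler intensity update can be written as a weighted sum of neighboring values: ρ⁺_{i,j} = w₀ ρ_{i,j} + w₁ ρ_{i+1,j} + w₂ ρ_{i−1,j} + w₃ ρ_{i,j+1} + w₄ ρ_{i,j−1}, where w₁ = (Δz/Δx)·(c^x_{i+½,j} − v^x_{i+½,j} − ω^x_{i+½,j})/2, w₂ = (Δz/Δx)·(c^x_{i−½,j} + v^x_{i−½,j} + ω^x_{i−½,j})/2, w₃ = (Δz/Δy)·(c^y_{i,j+½} − v^y_{i,j+½} − ω^y_{i,j+½})/2, w₄ = (Δz/Δy)·(c^y_{i,j−½} + v^y_{i,j−½} + ω^y_{i,j−½})/2, and w₀ = 1 − (Δz/Δx)·(v^x_{i+½,j}+ω^x_{i+½,j}+c^x_{i+½,j})/2 − (Δz/Δx)·(c^x_{i−½,j}−v^x_{i−½,j}−ω^x_{i−½,j})/2 − (Δz/Δy)·(v^y_{i,j+½}+ω^y_{i,j+½}+c^y_{i,j+½})/2 − (Δz/Δy)·(c^y_{i,j−½}−v^y_{i,j−½}−ω^y_{i,j−½})/2; moreover, with c = |v| + |ω| on each face, the neighbor weights w₁, w₂,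 w₃, w₄ are all nonnegative. -/
/-- **Weighted-sum form of the Rusanov forward Euler update and nonnegativity of the
neighbor weights.** At an interior cell with center value `ρC` and neighbors
`ρE, ρW, ρN, ρS` (east/west/north/south), face data `v, ω` and wave speeds
`c = |v| + |ω|` on the four surrounding faces, the update
`ρ⁺ = ρC − (Δz/Δx)(F^x_E − F^x_W) − (Δz/Δy)(F^y_N − F^y_S)` with Rusanov fluxes can be
rewritten as `ρ⁺ = w₀ ρC + w₁ ρE + w₂ ρW + w₃ ρN + w₄ ρS` with the stated weights, and
the neighbor weights `w₁, w₂, w₃, w₄` are all nonnegative. -/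
theorem rusanov_weighted_sum
    (Δx Δy Δz : ℝ) (hΔx : 0 < Δx) (hΔy : 0 < Δy) (hΔz : 0 < Δz)
    (ρC ρE ρW ρN ρS : ℝ)
    (vxE ωxE vxW ωxW vyN ωyN vyS ωyS : ℝ)
    (cxE cxW cyN cyS : ℝ)
    (hcxE : cxE = |vxE| + |ωxE|) (hcxW : cxW = |vxW| + |ωxW|)
    (hcyN : cyN = |vyN| + |ωyN|) (hcyS : cyS = |vyS| + |ωyS|)
    (FxE FxW FyN FyS : ℝ)
    (hFxE : FxE = (1 / 2) * (ρC + ρE) * (vxE + ωxE) - (1 / 2) * cxE * (ρE - ρC))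
    (hFxW : FxW = (1 / 2) * (ρW + ρC) * (vxW + ωxW) - (1 / 2) * cxW * (ρC - ρW))
    (hFyN : FyN = (1 / 2) * (ρC + ρN) * (vyN + ωyN) - (1 / 2) * cyN * (ρN - ρC))
    (hFyS : FyS = (1 / 2) * (ρS + ρC) * (vyS + ωyS) - (1 / 2) * cyS * (ρC - ρS))
    (ρplus : ℝ)
    (hupdate : ρplus = ρC - (Δz / Δx) * (FxE - FxW) - (Δz / Δy) * (FyN - FyS))
    (w0 w1 w2 w3 w4 : ℝ)
    (hw1 : w1 = (Δz / Δx) * ((cxE - vxE - ωxE) / 2))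
    (hw2 : w2 = (Δz / Δx) * ((cxW + vxW + ωxW) / 2))
    (hw3 : w3 = (Δz / Δy) * ((cyN - vyN - ωyN) / 2))
    (hw4 : w4 = (Δz / Δy) * ((cyS + vyS + ωyS) / 2))
    (hw0 : w0 = 1 - (Δz / Δx) * ((vxE + ωxE + cxE) / 2)
        - (Δz / Δx) * ((cxW - vxW - ωxW) / 2)
        - (Δz / Δy) * ((vyN + ωyN + cyN) / 2)
        - (Δz / Δy) * ((cyS - vyS - ωyS) / 2)) :
    ρplus = w0 * ρC + w1 * ρE + w2 * ρW + w3 * ρN + w4 * ρS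
      ∧ 0 ≤ w1 ∧ 0 ≤ w2 ∧ 0 ≤ w3 ∧ 0 ≤ w4 := by
  have hx : 0 ≤ Δz / Δx := (div_pos hΔz hΔx).le
  have hy : 0 ≤ Δz / Δy := (div_pos hΔz hΔy).le
  refine ⟨?_, ?_, ?_, ?_, ?_⟩
  · rw [hupdate, hFxE, hFxW, hFyN, hFyS, hw0, hw1, hw2, hw3, hw4]
    ring
  · rw [hw1]
    exact mul_nonneg hx (by linarith [le_abs_self vxE, le_abs_self ωxE])
  · rw [hw2]
    exact mul_nonneg hx (by linarith [neg_abs_le vxW, neg_abs_le ωxW])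
  · rw [hw3]
    exact mul_nonneg hy (by linarith [le_abs_self vyN, le_abs_self ωyN])
  · rw [hw4]
    exact mul_nonneg hy (by linarith [neg_abs_le vyS, neg_abs_le ωyS])
end
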